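/- Soundness of the equivariance algorithm 𝔈: If {t ≈ s}; ∇; A; Id ⟹* ∅; ∇; B; π is a derivation in 𝔈, where A = Atoms(t,s), then π is an A-based permutation such that ∇ ⊢ π•t ≈ s. -/

import Mathlib

set_option maxHeartbeats 1000000
abbrev Atom := ℕ
abbrev Var := ℕ
abbrev Fn := ℕ
abbrev NPerm := List (Atom × Atom)
def swapAtom (a b c : Atom) : Atom := if c = a then b else if c = b then a else c
def permAtom : NPerm → Atom → Atom
  | [], c => c
  | (a, b) :: π, c => swapAtom a b (permAtom π c)
def permInv (π : NPerm) : NPerm := π.reverse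
inductive NTerm where
  | app : Fn → List NTerm → NTerm
  | atom : Atom → NTerm
  | abs : Atom → NTerm → NTerm
  | susp : NPerm → Var → NTerm

def permTerm (π : NPerm) : NTerm → NTerm
  | .app f ts => .app f (ts.attach.map (fun x => permTerm π x.1))
  | .atom a => .atom (permAtom π a)
  | .abs a t => .abs (permAtom π a) (permTerm π t)
  | .susp ρ X => .susp (π ++ ρ) X
decreasing_by
  all_goals (simp_wf; try omega)
  all_goals (have := List.sizeOf_lt_of_mem x.2; omega)

/-- Substitutions (total maps from variables to terms; identity almost everywhere
is not required for the statements). -/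
abbrev NSubst := Var → NTerm

def idSubst : NSubst := fun X => .susp [] X

/-- Application of a substitution to a term (allowing atom capture and forcing
suspended permutations). -/
def substTerm (σ : NSubst) : NTerm → NTerm
  | .app f ts => .app f (ts.attach.map (fun x => substTerm σ x.1))
  | .atom a => .atom a
  | .abs a t => .abs a (substTerm σ t)
  | .susp π X => permTerm π (σ X)
decreasing_by
  all_goals (simp_wf; try omega)
  all_goals (have := List.sizeOf_lt_of_mem x.2; omega)

/-- Composition of substitutions: `t (σθ) = (tσ)θ`. -/
def substComp (σ θ : NSubst) : NSubst := fun X => substTerm θ (σ X)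

/-- Freshness contexts: finite sets of constraints `a # X`. -/
abbrev FCtx := Finset (Atom × Var)

/-- The freshness relation `Δ ⊢ a # t` (Urban–Pitts–Gabbay rules), stated for an
arbitrary set of freshness constraints. -/
inductive NFresh (Δ : Set (Atom × Var)) : Atom → NTerm → Prop
  | atom {a b : Atom} : a ≠ b → NFresh Δ a (.atom b)
  | susp {a : Atom} {π : NPerm} {X : Var} :
      (permAtom (permInv π) a, X) ∈ Δ → NFresh Δ a (.susp π X)
  | app {a : Atom} {f : Fn} {ts : List NTerm} :
      (∀ t ∈ ts, NFresh Δ a t) → NFresh Δ a (.app f ts)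
  | abs1 {a : Atom} {t : NTerm} : NFresh Δ a (.abs a t)
  | abs2 {a b : Atom} {t : NTerm} : a ≠ b → NFresh Δ a t → NFresh Δ a (.abs b t)

/-- The α-equivalence relation `Δ ⊢ t ≈ s` (Urban–Pitts–Gabbay rules). -/
inductive NAlpha (Δ : Set (Atom × Var)) : NTerm → NTerm → Prop
  | atom (a : Atom) : NAlpha Δ (.atom a) (.atom a)
  | abs1 {a : Atom} {t t' : NTerm} : NAlpha Δ t t' → NAlpha Δ (.abs a t) (.abs a t')
  | abs2 {a b : Atom} {t t' : NTerm} : a ≠ b → NAlpha Δ t (permTerm [(a, b)] t') →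
      NFresh Δ a t' → NAlpha Δ (.abs a t) (.abs b t')
  | susp {π π' : NPerm} {X : Var} :
      (∀ a : Atom, permAtom π a ≠ permAtom π' a → (a, X) ∈ Δ) →
      NAlpha Δ (.susp π X) (.susp π' X)
  | app {f : Fn} {ts ss : List NTerm} : ts.length = ss.length →
      (∀ p ∈ List.zip ts ss, NAlpha Δ p.1 p.2) →
      NAlpha Δ (.app f ts) (.app f ss)

/-- `FA⁻ˢ(t)`: atoms occurring freely in `t`, ignoring suspensions. -/
def FAnoSusp : NTerm → Finset Atom
  | .app _ ts => (ts.attach.map (fun x => FAnoSusp x.1)).foldr (· ∪ ·) ∅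
  | .atom a => {a}
  | .abs a t => FAnoSusp t \ {a}
  | .susp _ _ => ∅
decreasing_by
  all_goals (simp_wf; try omega)
  all_goals (have := List.sizeOf_lt_of_mem x.2; omega)

/-- A substitution respects a freshness context. -/
def Respects (σ : NSubst) (Δ : FCtx) : Prop :=
  ∀ a X, (a, X) ∈ Δ → a ∉ FAnoSusp (σ X)

/-! ### The algorithm FC -/

/-- A finite set of atomic freshness formulas `a # t`. -/
abbrev FProb := Multiset (Atom × NTerm)

/-- One step of the algorithm FC, transforming pairs `(F; Δ)`. -/
inductive FCStep : FProb × FCtx → FProb × FCtx → Prop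
  | del {a b : Atom} {F : FProb} {Δ : FCtx} : a ≠ b →
      FCStep ((a, .atom b) ::ₘ F, Δ) (F, Δ)
  | abs1 {a : Atom} {t : NTerm} {F : FProb} {Δ : FCtx} :
      FCStep ((a, .abs a t) ::ₘ F, Δ) (F, Δ)
  | abs2 {a b : Atom} {t : NTerm} {F : FProb} {Δ : FCtx} : a ≠ b →
      FCStep ((a, .abs b t) ::ₘ F, Δ) ((a, t) ::ₘ F, Δ)
  | dec {a : Atom} {f : Fn} {ts : List NTerm} {F : FProb} {Δ : FCtx} :
      FCStep ((a, .app f ts) ::ₘ F, Δ) (↑(ts.map (fun t => (a, t))) + F, Δ)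
  | sus {a : Atom} {π : NPerm} {X : Var} {F : FProb} {Δ : FCtx} :
      FCStep ((a, .susp π X) ::ₘ F, Δ) (F, insert (permAtom (permInv π) a, X) Δ)

/-- The algorithm FC succeeds on `F` with result `Γ`. -/
def FCReaches (F : FProb) (Γ : FCtx) : Prop :=
  Relation.ReflTransGen FCStep (F, ∅) (0, Γ)

/-- The algorithm FC fails on `F` (reaches a stuck state with remaining formulas). -/
def FCFails (F : FProb) : Prop :=
  ∃ st : FProb × FCtx, Relation.ReflTransGen FCStep (F, ∅) st ∧ st.1 ≠ 0 ∧
    ∀ st', ¬ FCStep st st'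

/-- The freshness problem `{a # Xσ | a#X ∈ Δ}` defining the instance `Δσ`. -/
def ctxSubstProb (Δ : FCtx) (σ : NSubst) : FProb :=
  Δ.val.map (fun c => (c.1, σ c.2))

/-! ### Terms-in-context and the subsumption order -/

/-- A term-in-context. -/
abbrev TIC := FCtx × NTerm

/-- `p ⪯ q`: the term-in-context `p` is more general than `q`.  (The condition
`p.1 σ ⊆ q.1` is expressed, equivalently by the properties of FC, as
`q.1 ⊢ a # Xσ` for all `a # X ∈ p.1`.) -/
def TIC.Le (p q : TIC) : Prop :=
  ∃ σ : NSubst, Respects σ p.1 ∧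
    (∀ c ∈ p.1, NFresh (↑q.1 : Set (Atom × Var)) c.1 (σ c.2)) ∧
    NAlpha (↑q.1 : Set (Atom × Var)) (substTerm σ p.2) q.2

/-- The strict part of `⪯`. -/
def TIC.Lt (p q : TIC) : Prop := TIC.Le p q ∧ ¬ TIC.Le q p

/-- Equi-generality `≃`. -/
def TIC.Equiv (p q : TIC) : Prop := TIC.Le p q ∧ TIC.Le q p

/-- `r` is a generalization of `p₁` and `p₂`. -/
def IsGen (r p₁ p₂ : TIC) : Prop := TIC.Le r p₁ ∧ TIC.Le r p₂

/-! ### Atoms, variables, basedness -/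

def permAtoms : NPerm → Finset Atom
  | [] => ∅
  | (a, b) :: π => insert a (insert b (permAtoms π))

def termAtoms : NTerm → Finset Atom
  | .app _ ts => (ts.attach.map (fun x => termAtoms x.1)).foldr (· ∪ ·) ∅
  | .atom a => {a}
  | .abs a t => insert a (termAtoms t)
  | .susp π _ => permAtoms π
decreasing_by
  all_goals (simp_wf; try omega)
  all_goals (have := List.sizeOf_lt_of_mem x.2; omega)

def termVars : NTerm → Finset Var
  | .app _ ts => (ts.attach.map (fun x => termVars x.1)).foldr (· ∪ ·) ∅
  | .atom _ => ∅
  | .abs _ t => termVars t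
  | .susp _ X => {X}
decreasing_by
  all_goals (simp_wf; try omega)
  all_goals (have := List.sizeOf_lt_of_mem x.2; omega)

/-- `FA(t)`: the atoms occurring freely in `t` (with `FA(π·X) = Atoms(π)`). -/
def termFA : NTerm → Finset Atom
  | .app _ ts => (ts.attach.map (fun x => termFA x.1)).foldr (· ∪ ·) ∅
  | .atom a => {a}
  | .abs a t => termFA t \ {a}
  | .susp π _ => permAtoms π
decreasing_by
  all_goals (simp_wf; try omega)
  all_goals (have := List.sizeOf_lt_of_mem x.2; omega)

def ctxAtoms (Δ : FCtx) : Finset Atom := Δ.image Prod.fst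
def ctxVars (Δ : FCtx) : Finset Var := Δ.image Prod.snd

def permBased (π : NPerm) (A : Finset Atom) : Prop := permAtoms π ⊆ A
def termBased (t : NTerm) (A : Finset Atom) : Prop := termAtoms t ⊆ A
def ctxBased (Δ : FCtx) (A : Finset Atom) : Prop := ctxAtoms Δ ⊆ A
def ticBased (p : TIC) (A : Finset Atom) : Prop := ctxBased p.1 A ∧ termBased p.2 A

/-- The number of abstraction occurrences in a term. -/
def absCount : NTerm → ℕ
  | .app _ ts => (ts.attach.map (fun x => absCount x.1)).sum
  | .atom _ => 0
  | .abs _ t => absCount t + 1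
  | .susp _ _ => 0
decreasing_by
  all_goals (simp_wf; try omega)
  all_goals (have := List.sizeOf_lt_of_mem x.2; omega)

/-! ### The nominal anti-unification algorithm 𝔑 -/

/-- Anti-unification triple `X : t ≜ s`. -/
abbrev AUT := Var × NTerm × NTerm

/-- A state of the algorithm 𝔑: the unsolved triples `P`, the store `S`, the
freshness context `Γ`, the substitution `σ`, and the set `V` of variables used
so far (needed to express freshness of the generated variables). -/
structure NState where
  P : Multiset AUT
  S : Multiset AUT
  Γ : FCtx
  σ : NSubst
  V : Finset Var

/-- `σ{X ↦ u}`. -/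
def updSubst (σ : NSubst) (X : Var) (u : NTerm) : NSubst :=
  substComp σ (fun Z => if Z = X then u else .susp [] Z)

/-- The head of a term (a function symbol together with its arity, an atom, the
abstraction operator, or a variable). -/
inductive NHead where
  | fn : Fn → ℕ → NHead
  | atom : Atom → NHead
  | abs : NHead
  | var : Var → NHead
deriving DecidableEq

def headOf : NTerm → NHead
  | .app f ts => .fn f ts.length
  | .atom a => .atom a
  | .abs _ _ => .abs
  | .susp _ X => .var X

def IsSusp : NTerm → Prop
  | .susp _ _ => True
  | _ => False

def IsAbs : NTerm → Prop
  | .abs _ _ => True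
  | _ => False

/-- The applicability condition of the rule Sol. -/
def SolCond (A : Finset Atom) (Δ : FCtx) (t s : NTerm) : Prop :=
  headOf t ≠ headOf s ∨ (IsSusp t ∧ IsSusp s) ∨
    (IsAbs t ∧ IsAbs s ∧
      ¬ ∃ c ∈ A, NFresh (↑Δ : Set (Atom × Var)) c t ∧ NFresh (↑Δ : Set (Atom × Var)) c s)

open Classical in
/-- `{a # X | a ∈ A, Δ ⊢ a # t, Δ ⊢ a # s}`. -/
noncomputable def solSet (A : Finset Atom) (Δ : FCtx) (t s : NTerm) (X : Var) : FCtx :=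
  (A.filter (fun a =>
    NFresh (↑Δ : Set (Atom × Var)) a t ∧ NFresh (↑Δ : Set (Atom × Var)) a s)).image
    (fun a => (a, X))

/-- `Γ{Y ↦ π·X}` on a freshness context. -/
def ctxRename (Γ : FCtx) (Y : Var) (π : NPerm) (X : Var) : FCtx :=
  Γ.image (fun c => if c.2 = Y then (permAtom (permInv π) c.1, X) else c)

/-- One step of the algorithm 𝔑, with global parameters `A` and `Δ`. -/
inductive NStep (A : Finset Atom) (Δ : FCtx) : NState → NState → Prop
  | decApp {X : Var} {f : Fn} {ts ss : List NTerm} {P S : Multiset AUT} {Γ : FCtx}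
      {σ : NSubst} {V : Finset Var} (Ys : List Var) :
      ts.length = ss.length → Ys.length = ts.length → Ys.Nodup →
      (∀ Y ∈ Ys, Y ∉ V) →
      NStep A Δ ⟨(X, .app f ts, .app f ss) ::ₘ P, S, Γ, σ, V⟩
        ⟨↑(List.zipWith (fun Y p => (Y, p)) Ys (List.zip ts ss)) + P, S, Γ,
         updSubst σ X (.app f (Ys.map (fun Y => .susp [] Y))), V ∪ Ys.toFinset⟩
  | decAtom {X : Var} {a : Atom} {P S : Multiset AUT} {Γ : FCtx} {σ : NSubst}
      {V : Finset Var} :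
      NStep A Δ ⟨(X, .atom a, .atom a) ::ₘ P, S, Γ, σ, V⟩
        ⟨P, S, Γ, updSubst σ X (.atom a), V⟩
  | abs {X : Var} {a b : Atom} {t s : NTerm} {P S : Multiset AUT} {Γ : FCtx}
      {σ : NSubst} {V : Finset Var} (Y : Var) (c : Atom) :
      Y ∉ V → c ∈ A →
      NFresh (↑Δ : Set (Atom × Var)) c (.abs a t) →
      NFresh (↑Δ : Set (Atom × Var)) c (.abs b s) →
      NStep A Δ ⟨(X, .abs a t, .abs b s) ::ₘ P, S, Γ, σ, V⟩
        ⟨(Y, permTerm [(c, a)] t, permTerm [(c, b)] s) ::ₘ P, S, Γ,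
         updSubst σ X (.abs c (.susp [] Y)), insert Y V⟩
  | sol {X : Var} {t s : NTerm} {P S : Multiset AUT} {Γ : FCtx} {σ : NSubst}
      {V : Finset Var} :
      SolCond A Δ t s →
      NStep A Δ ⟨(X, t, s) ::ₘ P, S, Γ, σ, V⟩
        ⟨P, (X, t, s) ::ₘ S, Γ ∪ solSet A Δ t s X, σ, V⟩
  | mer {X Y : Var} {t₁ s₁ t₂ s₂ : NTerm} {P S : Multiset AUT} {Γ : FCtx}
      {σ : NSubst} {V : Finset Var} (π : NPerm) :
      X ≠ Y →
      permBased π (termAtoms t₁ ∪ termAtoms s₁ ∪ termAtoms t₂ ∪ termAtoms s₂) →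
      NAlpha (↑Δ : Set (Atom × Var)) (permTerm π t₁) t₂ →
      NAlpha (↑Δ : Set (Atom × Var)) (permTerm π s₁) s₂ →
      NStep A Δ ⟨P, (X, t₁, s₁) ::ₘ (Y, t₂, s₂) ::ₘ S, Γ, σ, V⟩
        ⟨P, (X, t₁, s₁) ::ₘ S, ctxRename Γ Y π X, updSubst σ Y (.susp π X), V⟩

/-- The initial state of 𝔑 on the triple `X : t ≜ s`. -/
def initNState (X : Var) (t s : NTerm) (Δ : FCtx) : NState :=
  ⟨{(X, t, s)}, 0, ∅, idSubst, insert X (termVars t ∪ termVars s ∪ ctxVars Δ)⟩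

/-- An `A`-based least general generalization of `p₁` and `p₂`. -/
def IsABasedLgg (A : Finset Atom) (p p₁ p₂ : TIC) : Prop :=
  ticBased p A ∧ IsGen p p₁ p₂ ∧
    ¬ ∃ p' : TIC, ticBased p' A ∧ IsGen p' p₁ p₂ ∧ TIC.Lt p p'

/-! ### The equivariance algorithm 𝔈 -/

/-- A set of equivariance equations `t ≈ s`. -/
abbrev EProb := Multiset (NTerm × NTerm)

def eqsAtoms (E : EProb) : Finset Atom :=
  (E.map (fun e => termAtoms e.1 ∪ termAtoms e.2)).sup

def eqsVars (E : EProb) : Finset Var :=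
  (E.map (fun e => termVars e.1 ∪ termVars e.2)).sup

/-- All equations of `E` are equations between atoms. -/
def AtomEqs (E : EProb) : Prop := ∀ e ∈ E, ∃ a b : Atom, e = (NTerm.atom a, NTerm.atom b)

/-- One step of the equivariance algorithm 𝔈 (with fixed freshness context `Δ`) on
states `(E; A; π)`.  The first-phase rules require `π = Id`; the second-phase
rules require that only equations between atoms are left. -/
inductive EStep (Δ : FCtx) :
    EProb × Finset Atom × NPerm → EProb × Finset Atom × NPerm → Prop
  | dec {f : Fn} {ts ss : List NTerm} {E : EProb} {A : Finset Atom} :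
      ts.length = ss.length →
      EStep Δ ((.app f ts, .app f ss) ::ₘ E, A, []) (↑(List.zip ts ss) + E, A, [])
  | alp {a b : Atom} {t s : NTerm} {E : EProb} {A : Finset Atom} (c : Atom) :
      c ∉ A → c ∉ eqsAtoms ((.abs a t, .abs b s) ::ₘ E) → c ∉ ctxAtoms Δ →
      EStep Δ ((.abs a t, .abs b s) ::ₘ E, A, [])
        ((permTerm [(c, a)] t, permTerm [(c, b)] s) ::ₘ E, A, [])
  | sus {π₁ π₂ : NPerm} {X : Var} {E : EProb} {A : Finset Atom} :
      EStep Δ ((.susp π₁ X, .susp π₂ X) ::ₘ E, A, [])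
        (↑((A.filter (fun a => (a, X) ∉ Δ)).toList.map
            (fun a => (NTerm.atom (permAtom π₁ a), NTerm.atom (permAtom π₂ a)))) + E,
         A, [])
  | rem {a b : Atom} {E : EProb} {A : Finset Atom} {π : NPerm} :
      AtomEqs ((.atom a, .atom b) ::ₘ E) → permAtom π a = b →
      EStep Δ ((.atom a, .atom b) ::ₘ E, A, π) (E, A.erase b, π)
  | sol {a b : Atom} {E : EProb} {A : Finset Atom} {π : NPerm} :
      AtomEqs ((.atom a, .atom b) ::ₘ E) →
      permAtom π a ∈ A → b ∈ A → permAtom π a ≠ b →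
      EStep Δ ((.atom a, .atom b) ::ₘ E, A, π) (E, A.erase b, (permAtom π a, b) :: π)

/-! ### Permutations -/

theorem swapAtom_swapAtom (a b x : Atom) : swapAtom a b (swapAtom a b x) = x := by
  unfold swapAtom; grind

theorem permAtom_append (π ρ : NPerm) (x : Atom) :
    permAtom (π ++ ρ) x = permAtom π (permAtom ρ x) := by
  induction π with
  | nil => rfl
  | cons p π ih => simp [permAtom, ih]

theorem permAtom_permInv_permAtom (π : NPerm) (x : Atom) :
    permAtom (permInv π) (permAtom π x) = x := by
  induction π generalizing x with
  | nil => rfl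
  | cons p π ih =>
    have : permInv (p :: π) = permInv π ++ [p] := by simp [permInv]
    rw [this, permAtom_append]
    simp [permAtom, swapAtom_swapAtom, ih]

theorem permAtom_permAtom_permInv (π : NPerm) (x : Atom) :
    permAtom π (permAtom (permInv π) x) = x := by
  simpa [permInv] using permAtom_permInv_permAtom (permInv π) x

theorem permAtom_injective (π : NPerm) : Function.Injective (permAtom π) :=
  Function.LeftInverse.injective (permAtom_permInv_permAtom π)

theorem permAtom_eq_iff (π : NPerm) (x y : Atom) :
    permAtom π x = y ↔ x = permAtom (permInv π) y := by
  constructor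
  · rintro rfl; exact (permAtom_permInv_permAtom π x).symm
  · rintro rfl; exact permAtom_permAtom_permInv π y

theorem permAtom_swapAtom (π : NPerm) (a b x : Atom) :
    permAtom π (swapAtom a b x) = swapAtom (permAtom π a) (permAtom π b) (permAtom π x) := by
  unfold swapAtom
  simp only [(permAtom_injective π).eq_iff]
  split_ifs <;> rfl

theorem permAtom_of_notMem {π : NPerm} {x : Atom} (h : x ∉ permAtoms π) :
    permAtom π x = x := by
  induction π with
  | nil => rfl
  | cons p π ih =>
    obtain ⟨a, b⟩ := p
    simp only [permAtoms, Finset.mem_insert, not_or] at h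
    simp [permAtom, ih h.2.2, swapAtom, h.1, h.2.1]

theorem permAtom_permInv_of_notMem {π : NPerm} {x : Atom} (h : x ∉ permAtoms π) :
    permAtom (permInv π) x = x :=
  ((permAtom_eq_iff π x x).1 (permAtom_of_notMem h)).symm

theorem permAtom_mem {π : NPerm} {A : Finset Atom} (h : permAtoms π ⊆ A) {x : Atom}
    (hx : x ∈ A) : permAtom π x ∈ A := by
  induction π with
  | nil => exact hx
  | cons p π ih =>
    obtain ⟨a, b⟩ := p
    simp only [permAtoms, Finset.insert_subset_iff] at h
    simp only [permAtom, swapAtom]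
    split_ifs
    exacts [h.2.1, h.1, ih h.2.2]

theorem permAtoms_append (π ρ : NPerm) :
    permAtoms (π ++ ρ) = permAtoms π ∪ permAtoms ρ := by
  induction π with
  | nil => simp [permAtoms]
  | cons p π ih => simp [permAtoms, ih]

/-! ### Terms -/

theorem NTerm.induct {P : NTerm → Prop}
    (app : ∀ f ts, (∀ t ∈ ts, P t) → P (.app f ts)) (atom : ∀ a, P (.atom a))
    (abs : ∀ a t, P t → P (.abs a t)) (susp : ∀ π X, P (.susp π X)) (t : NTerm) : P t :=
  match t with
  | .app f ts => app f ts fun t _ => NTerm.induct app atom abs susp t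
  | .atom a => atom a
  | .abs a t => abs a t (NTerm.induct app atom abs susp t)
  | .susp π X => susp π X
termination_by sizeOf t

theorem permTerm_app (π : NPerm) (f : Fn) (ts : List NTerm) :
    permTerm π (.app f ts) = .app f (ts.map (permTerm π)) := by
  rw [permTerm]
  simp

theorem permTerm_atom (π : NPerm) (a : Atom) :
    permTerm π (.atom a) = .atom (permAtom π a) := by rw [permTerm]

theorem permTerm_abs (π : NPerm) (a : Atom) (t : NTerm) :
    permTerm π (.abs a t) = .abs (permAtom π a) (permTerm π t) := by rw [permTerm]

theorem permTerm_susp (π ρ : NPerm) (X : Var) :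
    permTerm π (.susp ρ X) = .susp (π ++ ρ) X := by rw [permTerm]

theorem permTerm_permTerm (π ρ : NPerm) (t : NTerm) :
    permTerm π (permTerm ρ t) = permTerm (π ++ ρ) t := by
  induction t using NTerm.induct with
  | app f ts ih => simpa [permTerm_app] using ih
  | atom a => simp [permTerm_atom, permAtom_append]
  | abs a t ih => simp [permTerm_abs, permAtom_append, ih]
  | susp τ X => simp [permTerm_susp]

theorem permTerm_nil (t : NTerm) : permTerm [] t = t := by
  induction t using NTerm.induct with
  | app f ts ih =>
    rw [permTerm_app, List.map_congr_left ih, List.map_id']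
  | atom a => simp [permTerm_atom, permAtom]
  | abs a t ih => simp [permTerm_abs, permAtom, ih]
  | susp τ X => simp [permTerm_susp]

theorem mem_termAtoms_app {x : Atom} {f : Fn} {ts : List NTerm} :
    x ∈ termAtoms (.app f ts) ↔ ∃ t ∈ ts, x ∈ termAtoms t := by
  have key : ∀ l : List NTerm,
      x ∈ (l.map termAtoms).foldr (· ∪ ·) ∅ ↔ ∃ t ∈ l, x ∈ termAtoms t := by
    intro l
    induction l with
    | nil => simp
    | cons t l ih => simp [ih]
  rw [termAtoms, ← key, List.attach_map_val]

theorem termAtoms_atom (a : Atom) : termAtoms (.atom a) = {a} := by rw [termAtoms]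

theorem termAtoms_abs (a : Atom) (t : NTerm) :
    termAtoms (.abs a t) = insert a (termAtoms t) := by rw [termAtoms]

theorem termAtoms_susp (π : NPerm) (X : Var) : termAtoms (.susp π X) = permAtoms π := by
  rw [termAtoms]

theorem termAtoms_subset_of_mem {f : Fn} {ts : List NTerm} {t : NTerm} (h : t ∈ ts) :
    termAtoms t ⊆ termAtoms (.app f ts) :=
  fun _ hx => mem_termAtoms_app.2 ⟨t, h, hx⟩

theorem termAtoms_permTerm_subset {π : NPerm} {A : Finset Atom} (hπ : permAtoms π ⊆ A)
    {t : NTerm} (ht : termAtoms t ⊆ A) : termAtoms (permTerm π t) ⊆ A := by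
  induction t using NTerm.induct with
  | app f ts ih =>
    intro x hx
    rw [permTerm_app, mem_termAtoms_app] at hx
    obtain ⟨u, hu, hx⟩ := hx
    obtain ⟨t, htm, rfl⟩ := List.mem_map.1 hu
    exact ih t htm ((termAtoms_subset_of_mem htm).trans ht) hx
  | atom a =>
    simp only [permTerm_atom, termAtoms_atom, Finset.singleton_subset_iff] at ht ⊢
    exact permAtom_mem hπ ht
  | abs a t ih =>
    simp only [permTerm_abs, termAtoms_abs, Finset.insert_subset_iff] at ht ⊢
    exact ⟨permAtom_mem hπ ht.1, ih ht.2⟩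
  | susp ρ X =>
    simp only [permTerm_susp, termAtoms_susp, permAtoms_append] at ht ⊢
    exact Finset.union_subset hπ ht

/-! ### Freshness -/

section
variable {Δ : Set (Atom × Var)}

theorem nFresh_atom_iff {a b : Atom} : NFresh Δ a (.atom b) ↔ a ≠ b :=
  ⟨fun h => by cases h; assumption, .atom⟩

theorem nFresh_susp_iff {a : Atom} {π : NPerm} {X : Var} :
    NFresh Δ a (.susp π X) ↔ (permAtom (permInv π) a, X) ∈ Δ :=
  ⟨fun h => by cases h; assumption, .susp⟩

theorem nFresh_app_iff {a : Atom} {f : Fn} {ts : List NTerm} :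
    NFresh Δ a (.app f ts) ↔ ∀ t ∈ ts, NFresh Δ a t :=
  ⟨fun h => by cases h; assumption, .app⟩

theorem nFresh_abs_iff {a b : Atom} {t : NTerm} :
    NFresh Δ a (.abs b t) ↔ a = b ∨ NFresh Δ a t := by
  constructor
  · intro h
    cases h with
    | abs1 => exact .inl rfl
    | abs2 _ h => exact .inr h
  · intro h
    by_cases hab : a = b
    · subst hab; exact .abs1
    · exact .abs2 hab (h.resolve_left hab)

theorem nFresh_permTerm_iff {a : Atom} {π : NPerm} {t : NTerm} :
    NFresh Δ a (permTerm π t) ↔ NFresh Δ (permAtom (permInv π) a) t := by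
  induction t using NTerm.induct with
  | app f ts ih =>
    simp only [permTerm_app, nFresh_app_iff, List.forall_mem_map]
    exact forall₂_congr ih
  | atom b => simp [permTerm_atom, nFresh_atom_iff, ← permAtom_eq_iff, eq_comm]
  | abs b t ih =>
    rw [permTerm_abs, nFresh_abs_iff, nFresh_abs_iff, ih]
    refine or_congr_left ?_
    rw [eq_comm, permAtom_eq_iff, eq_comm]
  | susp ρ X =>
    have : permInv (π ++ ρ) = permInv ρ ++ permInv π := by simp [permInv]
    rw [permTerm_susp, nFresh_susp_iff, nFresh_susp_iff, this, permAtom_append]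

theorem nFresh_of_notMem {a : Atom} {t : NTerm} (hΔ : ∀ X, (a, X) ∈ Δ)
    (h : a ∉ termAtoms t) : NFresh Δ a t := by
  induction t using NTerm.induct with
  | app f ts ih =>
    exact .app fun t ht => ih t ht fun hm => h (termAtoms_subset_of_mem ht hm)
  | atom b => exact .atom (by simpa [termAtoms_atom] using h)
  | abs b t ih =>
    simp only [termAtoms_abs, Finset.mem_insert, not_or] at h
    exact .abs2 h.1 (ih h.2)
  | susp π X =>
    rw [termAtoms_susp] at h
    rw [nFresh_susp_iff, permAtom_permInv_of_notMem h]
    exact hΔ X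

theorem NFresh.strengthen {Δ' : Set (Atom × Var)} {A : Finset Atom}
    (hΔ : ∀ c ∈ Δ', c.1 ∈ A → c ∈ Δ) {a : Atom} {t : NTerm} (h : NFresh Δ' a t)
    (ha : a ∈ A) (ht : termAtoms t ⊆ A) : NFresh Δ a t := by
  induction h with
  | atom h => exact .atom h
  | @susp π X h =>
    refine .susp (hΔ _ h ?_)
    rw [termAtoms_susp] at ht
    by_contra hn
    have := permAtom_of_notMem (π := π) fun hm => hn (ht hm)
    rw [permAtom_permAtom_permInv] at this
    exact hn (this ▸ ha)
  | app _ ih =>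
    exact .app fun t htm => ih t htm ((termAtoms_subset_of_mem htm).trans ht)
  | abs1 => exact .abs1
  | abs2 h _ ih =>
    rw [termAtoms_abs, Finset.insert_subset_iff] at ht
    exact .abs2 h (ih ht.2)

/-! ### α-equivalence -/

theorem forall_mem_zip_iff {α β : Type*} {l : List α} {m : List β} {R : α → β → Prop} :
    (l.length = m.length ∧ ∀ p ∈ l.zip m, R p.1 p.2) ↔ List.Forall₂ R l m := by
  simp [List.forall₂_iff_zip]

theorem nAlpha_app_iff {f g : Fn} {ts ss : List NTerm} :
    NAlpha Δ (.app f ts) (.app g ss) ↔ f = g ∧ List.Forall₂ (NAlpha Δ) ts ss := by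
  rw [← forall_mem_zip_iff]
  constructor
  · intro h
    cases h with
    | app h₁ h₂ => exact ⟨rfl, h₁, h₂⟩
  · rintro ⟨rfl, h₁, h₂⟩
    exact .app h₁ h₂

theorem nAlpha_abs_iff {a b : Atom} {t s : NTerm} :
    NAlpha Δ (.abs a t) (.abs b s) ↔ (a = b ∧ NAlpha Δ t s) ∨
      (a ≠ b ∧ NAlpha Δ t (permTerm [(a, b)] s) ∧ NFresh Δ a s) := by
  constructor
  · intro h
    cases h with
    | abs1 h => exact .inl ⟨rfl, h⟩
    | abs2 h₁ h₂ h₃ => exact .inr ⟨h₁, h₂, h₃⟩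
  · rintro (⟨rfl, h⟩ | ⟨h₁, h₂, h₃⟩)
    exacts [.abs1 h, .abs2 h₁ h₂ h₃]

theorem NFresh.nAlpha {t s : NTerm} (h : NAlpha Δ t s) {a : Atom} (ha : NFresh Δ a t) :
    NFresh Δ a s := by
  induction h generalizing a with
  | atom => exact ha
  | abs1 _ ih =>
    rw [nFresh_abs_iff] at ha ⊢
    exact ha.imp_right ih
  | @abs2 b c t s hbc _ hs ih =>
    rw [nFresh_abs_iff] at ha ⊢
    by_cases hab : a = b
    · exact .inr (hab ▸ hs)
    by_cases hac : a = c
    · exact .inl hac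
    have := ih (ha.resolve_left hab)
    rw [nFresh_permTerm_iff] at this
    simp only [permInv, List.reverse_singleton, permAtom, swapAtom, hab, hac, if_false] at this
    exact .inr this
  | @susp π ρ X h =>
    rw [nFresh_susp_iff] at ha ⊢
    by_cases hy : permAtom π (permAtom (permInv ρ) a) = a
    · rw [permAtom_eq_iff] at hy
      rwa [hy]
    · exact h _ (by rwa [permAtom_permAtom_permInv])
  | @app f ts ss hl _ ih =>
    rw [nFresh_app_iff] at ha ⊢
    intro s hs
    obtain ⟨i, hi, rfl⟩ := List.getElem_of_mem hs
    have hi' : i < ts.length := hl ▸ hi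
    refine ih (ts[i], ss[i]) ?_ (ha _ (List.getElem_mem hi'))
    exact List.mem_iff_getElem.2 ⟨i, by simp [hi, hi'], by simp⟩

theorem NFresh.permTerm_congr {τ τ' : NPerm} {s : NTerm} {a : Atom}
    (hfr : ∀ x, permAtom τ' x = a → permAtom τ x ≠ a → NFresh Δ x s)
    (h : NFresh Δ a (permTerm τ s)) : NFresh Δ a (permTerm τ' s) := by
  rw [nFresh_permTerm_iff] at h ⊢
  by_cases hy : permAtom τ (permAtom (permInv τ') a) = a
  · rw [permAtom_eq_iff] at hy
    rwa [hy]
  · exact hfr _ (permAtom_permAtom_permInv τ' a) hy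

theorem NAlpha.permTerm_right_congr {u s : NTerm} {τ τ' : NPerm}
    (hfr : ∀ x, permAtom τ x ≠ permAtom τ' x → NFresh Δ x s)
    (h : NAlpha Δ u (permTerm τ s)) : NAlpha Δ u (permTerm τ' s) := by
  induction s using NTerm.induct generalizing u τ τ' with
  | app f ss ih =>
    rw [permTerm_app] at h ⊢
    cases h with
    | @app _ us _ h₁ h₂ =>
      have h := (forall_mem_zip_iff (R := NAlpha Δ)).1 ⟨h₁, h₂⟩
      refine nAlpha_app_iff.2 ⟨rfl, ?_⟩
      rw [List.forall₂_map_right_iff] at h ⊢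
      rw [List.forall₂_iff_get] at h ⊢
      refine ⟨h.1, fun i hi hi' => ?_⟩
      exact ih _ (List.get_mem _ _) (fun x hx => nFresh_app_iff.1 (hfr x hx) _ (List.get_mem _ _))
        (h.2 i hi hi')
  | atom a =>
    rw [permTerm_atom] at h ⊢
    have : permAtom τ a = permAtom τ' a := by
      by_contra hn
      exact nFresh_atom_iff.1 (hfr a hn) rfl
    rwa [← this]
  | susp ρ X =>
    rw [permTerm_susp] at h ⊢
    cases h with
    | susp h =>
      refine .susp fun y hy => ?_
      by_cases hτ : permAtom τ (permAtom ρ y) = permAtom τ' (permAtom ρ y)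
      · exact h y (by rwa [permAtom_append, hτ, ← permAtom_append])
      · have := nFresh_susp_iff.1 (hfr _ hτ)
        rwa [permAtom_permInv_permAtom] at this
  | abs b s ih =>
    rw [permTerm_abs] at h ⊢
    have hfr' : ∀ x, x ≠ b → permAtom τ x ≠ permAtom τ' x → NFresh Δ x s := fun x hxb hx =>
      (nFresh_abs_iff.1 (hfr x hx)).resolve_left hxb
    have hinj : ∀ x, permAtom τ x = permAtom τ b ↔ x = b := fun x =>
      (permAtom_injective τ).eq_iff
    have hinj' : ∀ x, permAtom τ' x = permAtom τ' b ↔ x = b := fun x =>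
      (permAtom_injective τ').eq_iff
    have hfresh : ∀ a, a ≠ permAtom τ' b → a = permAtom τ b ∨ NFresh Δ a (permTerm τ s) →
        NFresh Δ a (permTerm τ' s) := by
      intro a ha h
      have aux : ∀ x, permAtom τ' x = a → permAtom τ x ≠ a → NFresh Δ x s := by
        intro x hx hx'
        exact hfr' x (by rintro rfl; exact ha hx.symm) (by rwa [hx])
      rcases h with rfl | h
      · rw [nFresh_permTerm_iff]
        have hy := permAtom_permAtom_permInv τ' (permAtom τ b)
        refine aux _ hy fun hb => ha ?_
        rw [hinj] at hb
        rw [← hy, hb]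
      · exact h.permTerm_congr aux
    obtain ⟨a, u, rfl⟩ : ∃ a u', u = .abs a u' := by cases h <;> exact ⟨_, _, rfl⟩
    rw [nAlpha_abs_iff] at h ⊢
    simp only [permTerm_permTerm] at h ⊢
    by_cases ha' : a = permAtom τ' b
    · refine .inl ⟨ha', ?_⟩
      rcases h with ⟨ha, h⟩ | ⟨ha, h, hs⟩
      · refine ih (fun x hx => hfr' x ?_ hx) h
        rintro rfl
        exact hx (ha ▸ ha')
      · refine ih (fun x hx => ?_) h
        have := hinj x
        have := hinj' x
        have := hfr' x
        simp only [List.cons_append, List.nil_append, permAtom, swapAtom] at hx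
        grind
    · refine .inr ⟨ha', ?_, hfresh a ha' (h.imp And.left fun h => h.2.2)⟩
      rcases h with ⟨ha, h⟩ | ⟨ha, h, hs⟩
      · refine ih (fun x hx => ?_) h
        have := hinj x
        have := hinj' x
        have := hfr' x
        simp only [List.cons_append, List.nil_append, permAtom, swapAtom] at hx
        grind
      · refine ih (fun x hx => ?_) h
        have := hinj x
        have := hinj' x
        have := hfr' x
        rw [nFresh_permTerm_iff] at hs
        have : permAtom τ x = a → NFresh Δ x s := fun hxa => by
          rwa [(permAtom_eq_iff τ x a).1 hxa]
        simp only [List.cons_append, List.nil_append, permAtom, swapAtom] at hx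
        grind

theorem NAlpha.permTerm_left_congr {u s : NTerm} {τ τ' : NPerm}
    (hτ : ∀ x, permAtom τ x = permAtom τ' x)
    (h : NAlpha Δ (permTerm τ u) s) : NAlpha Δ (permTerm τ' u) s := by
  induction u using NTerm.induct generalizing s with
  | app f us ih =>
    rw [permTerm_app] at h ⊢
    cases h with
    | @app _ _ ss h₁ h₂ =>
      have h := (forall_mem_zip_iff (R := NAlpha Δ)).1 ⟨h₁, h₂⟩
      refine nAlpha_app_iff.2 ⟨rfl, ?_⟩
      rw [List.forall₂_map_left_iff] at h ⊢
      rw [List.forall₂_iff_get] at h ⊢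
      exact ⟨h.1, fun i hi hi' => ih _ (List.get_mem _ _) (h.2 i hi hi')⟩
  | atom a => rwa [permTerm_atom, ← hτ, ← permTerm_atom]
  | abs a u ih =>
    obtain ⟨b, s, rfl⟩ : ∃ b s', s = .abs b s' := by
      rw [permTerm_abs] at h
      cases h <;> exact ⟨_, _, rfl⟩
    rw [permTerm_abs, nAlpha_abs_iff] at h ⊢
    rw [← hτ]
    exact h.imp (And.imp_right ih) (And.imp_right (And.imp_left ih))
  | susp ρ X =>
    rw [permTerm_susp] at h ⊢
    cases h with
    | susp h =>
      refine .susp fun y hy => h y ?_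
      rwa [permAtom_append, hτ, ← permAtom_append]

theorem NAlpha.permTerm {t s : NTerm} (h : NAlpha Δ t s) (π : NPerm) :
    NAlpha Δ (permTerm π t) (permTerm π s) := by
  induction h with
  | atom a => rw [permTerm_atom]; exact .atom _
  | abs1 _ ih => rw [permTerm_abs, permTerm_abs]; exact .abs1 ih
  | @abs2 a b t s hab _ hs ih =>
    rw [permTerm_abs, permTerm_abs]
    refine .abs2 ((permAtom_injective π).ne hab) ?_ ?_
    · rw [permTerm_permTerm] at ih ⊢
      refine ih.permTerm_right_congr fun x hx => absurd ?_ hx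
      simp [permAtom_append, permAtom, permAtom_swapAtom]
    · rwa [nFresh_permTerm_iff, permAtom_permInv_permAtom]
  | susp h =>
    rw [permTerm_susp, permTerm_susp]
    refine .susp fun a ha => h a fun he => ha ?_
    rw [permAtom_append, permAtom_append, he]
  | app hl _ ih =>
    rw [permTerm_app, permTerm_app]
    refine .app (by simpa using hl) ?_
    rw [List.zip_map]
    intro q hq
    obtain ⟨p, hp, rfl⟩ := List.mem_map.1 hq
    exact ih p hp

theorem NAlpha.strengthen {Δ' : Set (Atom × Var)} {A : Finset Atom}
    (hΔ : ∀ c ∈ Δ', c.1 ∈ A → c ∈ Δ) {t s : NTerm} (h : NAlpha Δ' t s)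
    (ht : termAtoms t ⊆ A) (hs : termAtoms s ⊆ A) : NAlpha Δ t s := by
  induction h with
  | atom a => exact .atom a
  | abs1 _ ih =>
    rw [termAtoms_abs, Finset.insert_subset_iff] at ht hs
    exact .abs1 (ih ht.2 hs.2)
  | abs2 hab _ hfr ih =>
    rw [termAtoms_abs, Finset.insert_subset_iff] at ht hs
    refine .abs2 hab (ih ht.2 (termAtoms_permTerm_subset ?_ hs.2)) (hfr.strengthen hΔ ht.1 hs.2)
    simp [permAtoms, Finset.insert_subset_iff, ht.1, hs.1]
  | susp h =>
    rw [termAtoms_susp] at ht hs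
    refine .susp fun a ha => hΔ _ (h a ha) ?_
    by_contra hn
    exact ha ((permAtom_of_notMem fun hm => hn (ht hm)).trans
      (permAtom_of_notMem fun hm => hn (hs hm)).symm)
  | app hl _ ih =>
    exact .app hl fun p hp => ih p hp
      ((termAtoms_subset_of_mem (List.of_mem_zip hp).1).trans ht)
      ((termAtoms_subset_of_mem (List.of_mem_zip hp).2).trans hs)

/-- α-equivalence of abstractions may be tested by renaming both bound atoms to a common
fresh one. -/
theorem NAlpha.abs_of_swap_fresh {a b c : Atom} {t s : NTerm} (hca : c ≠ a) (hcb : c ≠ b)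
    (ht : NFresh Δ c t) (hs : NFresh Δ c s)
    (h : NAlpha Δ (_root_.permTerm [(c, a)] t) (_root_.permTerm [(c, b)] s)) :
    NAlpha Δ (.abs a t) (.abs b s) := by
  have h' := h.permTerm [(c, a)]
  rw [permTerm_permTerm, permTerm_permTerm] at h'
  have h' := h'.permTerm_left_congr (τ' := []) fun x => by
    simp [permAtom, swapAtom_swapAtom]
  rw [permTerm_nil] at h'
  rw [nAlpha_abs_iff]
  by_cases hab : a = b
  · refine .inl ⟨hab, ?_⟩
    subst hab
    have := h'.permTerm_right_congr (τ' := []) fun x hx => absurd ?_ hx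
    · rwa [permTerm_nil] at this
    · simp [permAtom, swapAtom_swapAtom]
  · have has : NFresh Δ a s := by
      have := ht.nAlpha h'
      rw [nFresh_permTerm_iff] at this
      convert this using 1
      simp only [permInv, List.reverse_append, List.reverse_singleton]
      simp only [List.cons_append, List.nil_append, permAtom, swapAtom]
      grind
    refine .inr ⟨hab, h'.permTerm_right_congr fun x hx => ?_, has⟩
    simp only [List.cons_append, List.nil_append, permAtom, swapAtom] at hx
    grind

end

/-! ### Runs of the equivariance algorithm -/

theorem notMem_termAtoms_of_notMem_eqsAtoms {t s : NTerm} {E : EProb} {c : Atom}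
    (h : c ∉ eqsAtoms ((t, s) ::ₘ E)) : c ∉ termAtoms t ∧ c ∉ termAtoms s := by
  simp only [eqsAtoms, Multiset.map_cons, Multiset.sup_cons, Finset.sup_eq_union,
    Finset.mem_union, not_or] at h
  exact h.1

/-- A run on equations between atoms yields a permutation solving all of them; atoms already
mapped outside of `A` keep their image. -/
theorem eStep_atomEqs_sound {Δ : FCtx} {st : EProb × Finset Atom × NPerm}
    {B : Finset Atom} {π : NPerm} (h : Relation.ReflTransGen (EStep Δ) st (0, B, π))
    (hE : AtomEqs st.1) :
    permAtoms π ⊆ permAtoms st.2.2 ∪ st.2.1 ∧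
    (∀ x, permAtom st.2.2 x ∉ st.2.1 → permAtom π x = permAtom st.2.2 x) ∧
    ∀ a b : Atom, (NTerm.atom a, NTerm.atom b) ∈ st.1 → permAtom π a = b := by
  induction h using Relation.ReflTransGen.head_induction_on with
  | refl => simp
  | head hstep _ ih =>
    cases hstep with
    | dec => obtain ⟨a, b, h⟩ := hE _ (Multiset.mem_cons_self _ _); simp at h
    | alp => obtain ⟨a, b, h⟩ := hE _ (Multiset.mem_cons_self _ _); simp at h
    | sus => obtain ⟨a, b, h⟩ := hE _ (Multiset.mem_cons_self _ _); simp at h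
    | @rem a b E A ρ _ hab =>
      obtain ⟨h₁, h₂, h₃⟩ := ih fun e he => hE e (Multiset.mem_cons_of_mem he)
      simp only at h₁ h₂ h₃ ⊢
      refine ⟨h₁.trans (Finset.union_subset_union_right (Finset.erase_subset _ _)),
        fun x hx => h₂ x fun hm => hx (Finset.mem_of_mem_erase hm), fun x y hxy => ?_⟩
      rcases Multiset.mem_cons.1 hxy with he | he
      · simp only [Prod.mk.injEq, NTerm.atom.injEq] at he
        obtain ⟨rfl, rfl⟩ := he
        rw [h₂ x (by simp [hab]), hab]
      · exact h₃ x y he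
    | @sol a b E A ρ _ haA hbA hab =>
      obtain ⟨h₁, h₂, h₃⟩ := ih fun e he => hE e (Multiset.mem_cons_of_mem he)
      simp only [permAtom] at h₁ h₂ h₃ ⊢
      refine ⟨h₁.trans ?_, fun x hx => ?_, fun x y hxy => ?_⟩
      · intro x hx
        simp only [permAtoms, Finset.mem_union, Finset.mem_insert, Finset.mem_erase] at hx ⊢
        grind
      · have hsw : swapAtom (permAtom ρ a) b (permAtom ρ x) = permAtom ρ x := by
          unfold swapAtom
          grind
        rw [h₂ x (by rw [hsw]; exact fun hm => hx (Finset.mem_of_mem_erase hm)), hsw]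
      · rcases Multiset.mem_cons.1 hxy with he | he
        · simp only [Prod.mk.injEq, NTerm.atom.injEq] at he
          obtain ⟨rfl, rfl⟩ := he
          have hsw : swapAtom (permAtom ρ x) y (permAtom ρ x) = y := by simp [swapAtom]
          rw [h₂ x (by simp [hsw]), hsw]
        · exact h₃ x y he

/-- A run from the identity permutation yields an `A`-based permutation solving all equations
in the context extended by the freshness of all atoms outside of `A`. -/
theorem eStep_sound {Δ : FCtx} {st : EProb × Finset Atom × NPerm}
    {B : Finset Atom} {π : NPerm} (h : Relation.ReflTransGen (EStep Δ) st (0, B, π))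
    (hst : st.2.2 = []) :
    permAtoms π ⊆ st.2.1 ∧ ∀ e ∈ st.1,
      NAlpha {c : Atom × Var | c ∈ Δ ∨ c.1 ∉ st.2.1} (permTerm π e.1) e.2 := by
  have hatoms : ∀ st : EProb × Finset Atom × NPerm,
      Relation.ReflTransGen (EStep Δ) st (0, B, π) → st.2.2 = [] → AtomEqs st.1 →
      permAtoms π ⊆ st.2.1 ∧ ∀ e ∈ st.1,
        NAlpha {c : Atom × Var | c ∈ Δ ∨ c.1 ∉ st.2.1} (permTerm π e.1) e.2 := by
    intro st h hst hE
    obtain ⟨h₁, -, h₃⟩ := eStep_atomEqs_sound h hE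
    refine ⟨by simpa [hst, permAtoms] using h₁, fun e he => ?_⟩
    obtain ⟨a, b, rfl⟩ := hE e he
    rw [permTerm_atom, h₃ a b he]
    exact .atom b
  induction h using Relation.ReflTransGen.head_induction_on with
  | refl => exact hatoms _ .refl hst (by simp [AtomEqs])
  | head hstep hrun ih =>
    cases hstep with
    | rem hE hab => exact hatoms _ (.head (.rem hE hab) hrun) hst hE
    | sol hE h₁ h₂ h₃ => exact hatoms _ (.head (.sol hE h₁ h₂ h₃) hrun) hst hE
    | dec hl =>
      obtain ⟨h₁, h₂⟩ := ih rfl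
      refine ⟨h₁, fun e he => ?_⟩
      rcases Multiset.mem_cons.1 he with rfl | he
      · rw [permTerm_app, nAlpha_app_iff, List.forall₂_map_left_iff, ← forall_mem_zip_iff]
        exact ⟨rfl, hl, fun p hp =>
          h₂ p (Multiset.mem_add.2 (.inl (Multiset.mem_coe.2 hp)))⟩
      · exact h₂ e (Multiset.mem_add.2 (.inr he))
    | @alp a b t s E A c hcA hcE _ =>
      obtain ⟨h₁, h₂⟩ := ih rfl
      refine ⟨h₁, fun e he => ?_⟩
      rcases Multiset.mem_cons.1 he with rfl | he
      · have hc := notMem_termAtoms_of_notMem_eqsAtoms hcE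
        simp only [termAtoms_abs, Finset.mem_insert, not_or] at hc
        obtain ⟨⟨hca, hct⟩, hcb, hcs⟩ := hc
        have hcπ : c ∉ permAtoms π := fun hm => hcA (h₁ hm)
        have hπc : permAtom π c = c := permAtom_of_notMem hcπ
        rw [permTerm_abs]
        refine NAlpha.abs_of_swap_fresh (c := c) ?_ hcb ?_
          (nFresh_of_notMem (fun X => .inr hcA) hcs) ?_
        · intro hc
          exact hca (permAtom_injective π (hπc.trans hc))
        · rw [nFresh_permTerm_iff, permAtom_permInv_of_notMem hcπ]
          exact nFresh_of_notMem (fun X => .inr hcA) hct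
        · have h := h₂ _ (Multiset.mem_cons_self _ _)
          simp only [permTerm_permTerm] at h ⊢
          refine h.permTerm_left_congr fun x => ?_
          simp [permAtom_append, permAtom, permAtom_swapAtom, hπc]
      · exact h₂ e (Multiset.mem_cons_of_mem he)
    | @sus π₁ π₂ X E A =>
      obtain ⟨h₁, h₂⟩ := ih rfl
      refine ⟨h₁, fun e he => ?_⟩
      rcases Multiset.mem_cons.1 he with rfl | he
      · rw [permTerm_susp]
        refine .susp fun a ha => ?_
        by_contra hn
        simp only [Set.mem_ofPred_eq, not_or, not_not] at hn
        have h := h₂ (.atom (permAtom π₁ a), .atom (permAtom π₂ a))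
          (Multiset.mem_add.2 (.inl (Multiset.mem_coe.2 (List.mem_map.2
            ⟨a, by simp [hn.1, hn.2], rfl⟩))))
        rw [permTerm_atom, ← permAtom_append] at h
        generalize permAtom (π ++ π₁) a = x at h ha
        cases h
        exact ha rfl
      · exact h₂ e (Multiset.mem_add.2 (.inr he))

/-- soundness of the equivariance algorithm 𝔈: if
`{t ≈ s}; Δ; Atoms(t,s); Id ⟹* ∅; Δ; B; π`, then `π` is an `Atoms(t,s)`-based
permutation with `Δ ⊢ π•t ≈ s`. -/
theorem equivariance_soundness (Δ : FCtx) (t s : NTerm) (B : Finset Atom) (π : NPerm)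
    (h : Relation.ReflTransGen (EStep Δ)
          ({(t, s)}, termAtoms t ∪ termAtoms s, []) (0, B, π)) :
    permBased π (termAtoms t ∪ termAtoms s) ∧
    NAlpha (↑Δ : Set (Atom × Var)) (permTerm π t) s := by
  obtain ⟨hπ, hE⟩ := eStep_sound h rfl
  refine ⟨hπ, (hE (t, s) (Multiset.mem_singleton_self _)).strengthen ?_
    (termAtoms_permTerm_subset hπ Finset.subset_union_left) Finset.subset_union_right⟩
  rintro c (hc | hc) hcA
  exacts [hc, absurd hcA hc]
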